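/- arXiv:2410.03471 — 2 statements merged into one kernel-verified Lean document; each statement's English description precedes it below -/
import Mathlib

section
/- Let b ∈ (0,1] and let (a_n)_{n∈ℕ} be a non-increasing sequence of positive real numbers converging to zero such that a₁ ≤ α for some constant α with 0 < α < b. Then there exists a sequence (p_k)_{k∈ℕ} of non-negative real numbers satisfying Σ_{k=1}^∞ p_k = b and Σ_{k=1}^∞ p_k (1 − p_k/b)^n ≥ a_n for every n ∈ ℕ. -/
open Filter

lemma block_hasSum (v : ℕ → ℝ) (S : ℝ) (hv : ∀ i, 0 ≤ v i) (hS : HasSum v S)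
    (M : ℕ → ℕ) (hM : ∀ i, 0 < M i) :
    HasSum (fun x : ℕ × ℕ => if x.2 < M x.1 then v x.1 / M x.1 else 0) S := by
  have hf : ∀ i, HasSum (fun m : ℕ => if m < M i then v i / M i else 0) (v i) := by
    intro i
    have h := hasSum_sum_of_ne_finset_zero (L := SummationFilter.unconditional ℕ) (f := fun m : ℕ => if m < M i then v i / M i else 0)
      (s := Finset.range (M i)) (by
        intro m hm
        simp only [Finset.mem_range] at hm
        simp [hm])
    have e : ∑ m ∈ Finset.range (M i), (if m < M i then v i / M i else 0) = v i := by
      rw [Finset.sum_congr rfl (g := fun _ => v i / (M i : ℝ))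
        (fun m hm => if_pos (Finset.mem_range.1 hm))]
      have : (M i : ℝ) ≠ 0 := by exact_mod_cast (hM i).ne'
      simp only [Finset.sum_const, Finset.card_range, nsmul_eq_mul]
      field_simp
    rwa [e] at h
  have hs : Summable (fun x : ℕ × ℕ => if x.2 < M x.1 then v x.1 / (M x.1 : ℝ) else 0) := by
    rw [summable_prod_of_nonneg]
    · refine ⟨fun i => (hf i).summable, ?_⟩
      have : (fun i => ∑' m : ℕ, (if m < M i then v i / (M i : ℝ) else 0)) = v :=
        funext fun i => (hf i).tsum_eq
      simpa only [this] using hS.summable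
    · intro x
      have := hv x.1
      simp only [Pi.zero_apply]
      split_ifs <;> positivity
  have h2 := hs.hasSum.prod_fiberwise hf
  have h3 := hs.hasSum
  rw [h2.unique hS] at h3
  exact h3

lemma tail_hasSum (c : ℝ) (j : ℕ) :
    HasSum (fun i : ℕ => if j ≤ i then c * (1/2 : ℝ)^(i+1) else 0) (c * (1/2 : ℝ)^j) := by
  rw [← hasSum_nat_add_iff' j]
  have h := (hasSum_geometric_two).mul_left (c * (1/2 : ℝ)^(j+1))
  have e1 : (fun i : ℕ => if j ≤ i + j then c * (1/2 : ℝ)^(i+j+1) else 0)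
      = fun i => c * (1/2 : ℝ)^(j+1) * (1/2 : ℝ)^i := by
    funext i
    simp only [Nat.le_add_left, if_true]
    ring
  have e2 : c * (1/2 : ℝ)^j - ∑ i ∈ Finset.range j, (if j ≤ i then c * (1/2 : ℝ)^(i+1) else 0)
      = c * (1/2 : ℝ)^(j+1) * 2 := by
    rw [Finset.sum_eq_zero]
    · ring
    · intro i hi
      simp only [Finset.mem_range] at hi
      simp [hi]
  rw [e1, e2]
  exact h

set_option maxHeartbeats 1000000 in
/-- **Lemma (sequence construction, Győrfi et al.):** for `b ∈ (0,1]` and a non-increasing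
positive sequence `a` converging to zero with `a 1 ≤ α < b`, there is a sequence `p` of
non-negative reals summing to `b` with `∑_k p_k (1 - p_k/b)^n ≥ a_n` for every `n ≥ 1`. -/
theorem stmt_3 (b α : ℝ) (hb0 : 0 < b) (hb1 : b ≤ 1)
    (a : ℕ → ℝ) (hapos : ∀ n, 0 < a n) (hmono : Antitone a)
    (hlim : Tendsto a atTop (nhds 0))
    (hα0 : 0 < α) (hαb : α < b) (ha1 : a 1 ≤ α) :
    ∃ p : ℕ → ℝ, (∀ k, 0 ≤ p k) ∧ HasSum p b ∧
      ∀ n : ℕ, 1 ≤ n → a n ≤ ∑' k, p k * (1 - p k / b) ^ n := by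
  have hN : ∀ i : ℕ, ∃ N : ℕ, ∀ n, N ≤ n → a n ≤ α * (1/2 : ℝ)^i := by
    intro i
    have h : ∀ᶠ n in atTop, a n < α * (1/2 : ℝ)^i := hlim.eventually_lt_const (by positivity)
    obtain ⟨N, hN⟩ := eventually_atTop.1 h
    exact ⟨N, fun n hn => (hN n hn).le⟩
  choose N hN using hN
  have hγ : 0 < 1 - α / b := by
    rw [sub_pos, div_lt_one hb0]; exact hαb
  have hM : ∀ i : ℕ, ∃ M : ℕ, 0 < M ∧ (N (i+1) : ℝ) ≤ M * (1 - α / b) := by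
    intro i
    obtain ⟨M, hM⟩ := exists_nat_ge ((N (i+1) : ℝ) / (1 - α / b))
    refine ⟨M + 1, Nat.succ_pos _, ?_⟩
    rw [div_le_iff₀ hγ] at hM
    push_cast
    linarith
  choose M hM0 hM using hM
  let q : ℕ × ℕ → ℝ := fun x => if x.2 < M x.1 then b * (1/2 : ℝ)^(x.1+1) / M x.1 else 0
  have hq0 : ∀ x, 0 ≤ q x := by
    intro x
    simp only [q]
    split_ifs <;> positivity
  have hqs : HasSum q b := by
    have h := tail_hasSum b 0
    simp only [Nat.zero_le, if_true, pow_zero, mul_one] at h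
    exact block_hasSum (fun i => b * (1/2 : ℝ)^(i+1)) b (fun i => by positivity) h M hM0
  have hqb : ∀ x, q x / b ≤ 1 := by
    intro x
    rw [div_le_one hb0]
    exact le_hasSum hqs x (fun y _ => hq0 y)
  have key : ∀ n : ℕ, 1 ≤ n → a n ≤ ∑' x, q x * (1 - q x / b) ^ n := by
    intro n hn
    have hex : ∃ k : ℕ, α * (1/2 : ℝ)^k < a n := by
      obtain ⟨k, hk⟩ := exists_pow_lt_of_lt_one (div_pos (hapos n) hα0)
        (by norm_num : (1/2 : ℝ) < 1)
      refine ⟨k, ?_⟩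
      rw [lt_div_iff₀ hα0] at hk
      linarith
    classical
    obtain ⟨j, hj⟩ : ∃ j, Nat.find hex = j + 1 := by
      apply Nat.exists_eq_succ_of_ne_zero
      intro h0
      have := Nat.find_spec hex
      rw [h0, pow_zero, mul_one] at this
      linarith [hmono hn]
    have h1 : a n ≤ α * (1/2 : ℝ)^j := not_lt.1 (Nat.find_min hex (m := j) (by omega))
    have h2 := Nat.find_spec hex
    rw [hj] at h2
    have hlt : ∀ i, j ≤ i → n < N (i+1) := by
      intro i hi
      by_contra hc
      have h3 := hN (i+1) n (not_lt.1 hc)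
      have h4 : (1/2 : ℝ)^(i+1) ≤ (1/2 : ℝ)^(j+1) :=
        pow_le_pow_of_le_one (by norm_num) (by norm_num) (by omega)
      have := mul_le_mul_of_nonneg_left h4 hα0.le
      linarith
    have hh := block_hasSum (fun i : ℕ => if j ≤ i then α * (1/2 : ℝ)^(i+1) else 0)
      (α * (1/2 : ℝ)^j) (fun i => by split_ifs <;> positivity) (tail_hasSum α j) M hM0
    have hgs : Summable (fun x => q x * (1 - q x / b) ^ n) := by
      refine Summable.of_nonneg_of_le (fun x => ?_) (fun x => ?_) hqs.summable
      · exact mul_nonneg (hq0 x) (pow_nonneg (by linarith [hqb x]) n)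
      · refine mul_le_of_le_one_right (hq0 x) (pow_le_one₀ (by linarith [hqb x]) ?_)
        have := div_nonneg (hq0 x) hb0.le
        linarith
    refine h1.trans (hasSum_le (fun x => ?_) hh hgs.hasSum)
    have hnn : 0 ≤ q x * (1 - q x / b) ^ n :=
      mul_nonneg (hq0 x) (pow_nonneg (by linarith [hqb x]) n)
    by_cases hx : x.2 < M x.1
    · by_cases hji : j ≤ x.1
      · have hMp : (0 : ℝ) < M x.1 := by exact_mod_cast hM0 x.1
        have hqx : q x = b * (1/2 : ℝ)^(x.1+1) / M x.1 := if_pos hx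
        simp only [hx, hji, if_true]
        have e : α * (1/2 : ℝ)^(x.1+1) / M x.1 = q x * (α / b) := by
          rw [hqx]; field_simp
        rw [e]
        refine mul_le_mul_of_nonneg_left ?_ (hq0 x)
        have hB := one_add_mul_le_pow (a := -(q x / b)) (by linarith [hqb x]) n
        have hqM : q x / b ≤ 1 / M x.1 := by
          have e2 : q x / b = (1/2 : ℝ)^(x.1+1) / M x.1 := by
            rw [hqx]; field_simp
          rw [e2]
          gcongr
          exact pow_le_one₀ (by norm_num) (by norm_num)
        have hnM : (n : ℝ) * (q x / b) ≤ 1 - α / b := by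
          have hnN : (n : ℝ) ≤ N (x.1+1) := by exact_mod_cast (hlt _ hji).le
          calc (n : ℝ) * (q x / b) ≤ n * (1 / M x.1) := by gcongr
            _ = n / M x.1 := by ring
            _ ≤ 1 - α / b := by
              rw [div_le_iff₀ hMp]
              linarith [hM x.1]
        rw [← sub_eq_add_neg] at hB
        linarith
      · simpa [hji] using hnn
    · simpa [hx] using hnn
  obtain ⟨e⟩ : Nonempty (ℕ ≃ ℕ × ℕ) := ⟨Nat.pairEquiv.symm⟩
  refine ⟨fun k => q (e k), fun k => hq0 _, e.hasSum_iff.2 hqs, fun n hn => ?_⟩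
  have := e.tsum_eq (fun x => q x * (1 - q x / b) ^ n)
  rw [this]
  exact key n hn
end

section
/- Let (Ω, 𝓕, μ) be a probability space, J ∈ ℕ, and let A : Ω → (J×J real matrices) and b, w : Ω → ℝ^J be measurable maps with A(ω) symmetric positive definite for almost every ω. Assume that the real random variables wᵀAw, bᵀA^{-1}b and bᵀw are integrable. Then (𝔼[bᵀw])² ≤ 𝔼[wᵀAw] · 𝔼[bᵀA^{-1}b], and equality holds when w = A^{-1}b almost everywhere. In particular, if 𝔼[bᵀA^{-1}b] > 0, then among all w with 𝔼[bᵀw] ≠ 0 the functional 𝔼[wᵀAw]/(𝔼[bᵀw])² is minimised, with minimum value (𝔼[bᵀA^{-1}b])^{-1}, by w = A^{-1}b. -/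
open MeasureTheory Matrix

theorem aux_quad {J : ℕ} (A : Matrix (Fin J) (Fin J) ℝ) (hA : A.PosDef) (b w : Fin J → ℝ)
    (t : ℝ) :
    0 ≤ t ^ 2 * (w ⬝ᵥ A *ᵥ w) - 2 * t * (b ⬝ᵥ w) + b ⬝ᵥ A⁻¹ *ᵥ b := by
  have hu : IsUnit A.det := (Matrix.isUnit_iff_isUnit_det A).1 hA.isUnit
  have hAu : A *ᵥ (A⁻¹ *ᵥ b) = b := by
    rw [Matrix.mulVec_mulVec, Matrix.mul_nonsing_inv A hu, Matrix.one_mulVec]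
  have hT : Aᵀ = A := by
    have := hA.isHermitian.eq
    rwa [Matrix.conjTranspose_eq_transpose_of_trivial] at this
  have hsw : (A⁻¹ *ᵥ b) ⬝ᵥ A *ᵥ w = b ⬝ᵥ w := by
    rw [Matrix.dotProduct_mulVec, ← Matrix.mulVec_transpose, hT, hAu]
  have h := hA.posSemidef.dotProduct_mulVec_nonneg (t • w - A⁻¹ *ᵥ b)
  rw [star_trivial, Matrix.mulVec_sub, Matrix.mulVec_smul, hAu] at h
  simp only [sub_dotProduct, dotProduct_sub, smul_dotProduct, dotProduct_smul, smul_eq_mul,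
    hsw] at h
  rw [dotProduct_comm w b, dotProduct_comm _ b] at h
  linarith

/-- **Optimality of the ROSE weights (matrix Cauchy–Schwarz for the sandwich loss):**
for a.e.-positive-definite random matrices `A` and random vectors `b, w` with the relevant
integrabilities, `(𝔼[bᵀw])² ≤ 𝔼[wᵀAw]·𝔼[bᵀA⁻¹b]`, with equality when `w = A⁻¹b` a.e.;
in particular, if `𝔼[bᵀA⁻¹b] > 0` then for `𝔼[bᵀw] ≠ 0` the sandwich loss
`𝔼[wᵀAw]/(𝔼[bᵀw])²` is at least `(𝔼[bᵀA⁻¹b])⁻¹`. -/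
theorem stmt_8 {Ω : Type*} [MeasurableSpace Ω] (μ : Measure Ω)
    [IsProbabilityMeasure μ] (J : ℕ)
    (A : Ω → Matrix (Fin J) (Fin J) ℝ) (b w : Ω → Fin J → ℝ)
    (hAmeas : ∀ i j, Measurable fun ω => A ω i j)
    (hbmeas : Measurable b) (hwmeas : Measurable w)
    (hA : ∀ᵐ ω ∂μ, (A ω).PosDef)
    (h1 : Integrable (fun ω => w ω ⬝ᵥ (A ω) *ᵥ w ω) μ)
    (h2 : Integrable (fun ω => b ω ⬝ᵥ (A ω)⁻¹ *ᵥ b ω) μ)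
    (h3 : Integrable (fun ω => b ω ⬝ᵥ w ω) μ) :
    (∫ ω, b ω ⬝ᵥ w ω ∂μ) ^ 2 ≤
        (∫ ω, w ω ⬝ᵥ (A ω) *ᵥ w ω ∂μ) * (∫ ω, b ω ⬝ᵥ (A ω)⁻¹ *ᵥ b ω ∂μ) ∧
      ((∀ᵐ ω ∂μ, w ω = (A ω)⁻¹ *ᵥ b ω) →
        (∫ ω, b ω ⬝ᵥ w ω ∂μ) ^ 2 =
          (∫ ω, w ω ⬝ᵥ (A ω) *ᵥ w ω ∂μ) * (∫ ω, b ω ⬝ᵥ (A ω)⁻¹ *ᵥ b ω ∂μ)) ∧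
      (0 < ∫ ω, b ω ⬝ᵥ (A ω)⁻¹ *ᵥ b ω ∂μ → (∫ ω, b ω ⬝ᵥ w ω ∂μ) ≠ 0 →
        (∫ ω, b ω ⬝ᵥ (A ω)⁻¹ *ᵥ b ω ∂μ)⁻¹ ≤
          (∫ ω, w ω ⬝ᵥ (A ω) *ᵥ w ω ∂μ) / (∫ ω, b ω ⬝ᵥ w ω ∂μ) ^ 2) := by
  have key : (∫ ω, b ω ⬝ᵥ w ω ∂μ) ^ 2 ≤
        (∫ ω, w ω ⬝ᵥ (A ω) *ᵥ w ω ∂μ) * (∫ ω, b ω ⬝ᵥ (A ω)⁻¹ *ᵥ b ω ∂μ) := by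
    have hq : ∀ t : ℝ, 0 ≤ (∫ ω, w ω ⬝ᵥ (A ω) *ᵥ w ω ∂μ) * (t * t) +
        (-2 * ∫ ω, b ω ⬝ᵥ w ω ∂μ) * t + ∫ ω, b ω ⬝ᵥ (A ω)⁻¹ *ᵥ b ω ∂μ := by
      intro t
      have h0 : 0 ≤ ∫ ω, (t ^ 2 * (w ω ⬝ᵥ A ω *ᵥ w ω) - 2 * t * (b ω ⬝ᵥ w ω)
          + b ω ⬝ᵥ (A ω)⁻¹ *ᵥ b ω) ∂μ := by
        apply integral_nonneg_of_ae
        filter_upwards [hA] with ω hω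
        exact aux_quad (A ω) hω (b ω) (w ω) t
      have hi : Integrable (fun ω => t ^ 2 * (w ω ⬝ᵥ A ω *ᵥ w ω) - 2 * t * (b ω ⬝ᵥ w ω)) μ :=
        (h1.const_mul _).sub (h3.const_mul _)
      rw [integral_add hi h2,
        integral_sub (h1.const_mul _) (h3.const_mul _), integral_const_mul,
        integral_const_mul] at h0
      linarith
    have hd := discrim_le_zero hq
    unfold discrim at hd
    nlinarith
  refine ⟨key, ?_, ?_⟩
  · intro hw
    have e1 : (∫ ω, b ω ⬝ᵥ w ω ∂μ) = ∫ ω, b ω ⬝ᵥ (A ω)⁻¹ *ᵥ b ω ∂μ := by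
      apply integral_congr_ae
      filter_upwards [hw] with ω hω
      rw [hω]
    have e2 : (∫ ω, w ω ⬝ᵥ (A ω) *ᵥ w ω ∂μ) = ∫ ω, b ω ⬝ᵥ (A ω)⁻¹ *ᵥ b ω ∂μ := by
      apply integral_congr_ae
      filter_upwards [hw, hA] with ω hω hp
      have hu : IsUnit (A ω).det := (Matrix.isUnit_iff_isUnit_det _).1 hp.isUnit
      rw [hω, Matrix.mulVec_mulVec, Matrix.mul_nonsing_inv _ hu, Matrix.one_mulVec,
        dotProduct_comm]
    rw [e1, e2, sq]
  · intro hpos hne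
    rw [inv_eq_one_div, div_le_div_iff₀ hpos (by positivity), one_mul]
    exact key
end
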